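/- arXiv:2503.15640 — 2 statements merged into one kernel-verified Lean document; each statement's English description precedes it below -/
import Mathlib

section
/- Let D ≥ 2, L ≥ 1, and let h be a local operator of range r ≤ L on (ℂ^D)^{⊗r} that is antisymmetric with respect to transposition in the computational basis: hᵀ = −h. Then the Hamiltonian H = Σ_{j=0}^{2L−1} h(j), where h(j) is the translate of h acting on sites j, …, j+r−1 (mod 2L) of a periodic chain of 2L sites, annihilates the identity crosscap state: H|Ψ₀⟩ = 0. -/
open Matrix BigOperators

/-- The site `j + k` modulo the chain length `n`. -/
def shiftSite {n : ℕ} (j : Fin n) (k : ℕ) : Fin n :=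
  ⟨(j.val + k) % n, Nat.mod_lt _ (Nat.lt_of_le_of_lt (Nat.zero_le _) j.isLt)⟩

/-- Site `j` (for `j < L`) viewed as a site of the chain of length `2*L`. -/
def lo {L : ℕ} (j : Fin L) : Fin (2 * L) := ⟨j.val, by have := j.isLt; omega⟩

/-- The antipodal site `j + L` of the chain of length `2*L`. -/
def hi {L : ℕ} (j : Fin L) : Fin (2 * L) := ⟨j.val + L, by have := j.isLt; omega⟩

/-- The crosscap state built from the `D × D` matrix `A` on a periodic chain of `2*L` sites:
its coefficient on the computational basis state `f` is `∏_{j=0}^{L-1} A (f j) (f (j+L))`. -/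
noncomputable def crosscap (L D : ℕ) (A : Matrix (Fin D) (Fin D) ℂ) :
    (Fin (2 * L) → Fin D) → ℂ :=
  fun f => ∏ j : Fin L, A (f (lo j)) (f (hi j))

/-- The translate `h(j)` of a local operator `h` of range `r`, acting on the sites
`j, j+1, …, j+r-1` (mod `n`) of a periodic chain of `n` sites, and as the identity elsewhere. -/
noncomputable def localOp {n D : ℕ} (r : ℕ)
    (h : Matrix (Fin r → Fin D) (Fin r → Fin D) ℂ) (j : Fin n) :
    Matrix (Fin n → Fin D) (Fin n → Fin D) ℂ :=
  Matrix.of fun f g =>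
    h (fun k => f (shiftSite j k.val)) (fun k => g (shiftSite j k.val)) *
      ∏ i : Fin n, if (∃ k : Fin r, i = shiftSite j k.val) ∨ f i = g i then 1 else 0

/-- The `r`-fold Kronecker power `A^{⊗r}` of a `D × D` matrix `A`. -/
noncomputable def kronPow {D : ℕ} (r : ℕ) (A : Matrix (Fin D) (Fin D) ℂ) :
    Matrix (Fin r → Fin D) (Fin r → Fin D) ℂ :=
  Matrix.of fun f g => ∏ k : Fin r, A (f k) (g k)

/-- The one-site operator `M` acting at site `j`, identity elsewhere. -/
noncomputable def oneSite {n D : ℕ} (M : Matrix (Fin D) (Fin D) ℂ) (j : Fin n) :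
    Matrix (Fin n → Fin D) (Fin n → Fin D) ℂ :=
  Matrix.of fun f g => M (f j) (g j) * ∏ i : Fin n, if i = j ∨ f i = g i then 1 else 0

/-- The antipodal site `i + L` of a site `i` of the chain of length `2 * L`. -/
def antipode {L : ℕ} (i : Fin (2 * L)) : Fin (2 * L) := shiftSite i L

lemma antipode_val {L : ℕ} (i : Fin (2 * L)) :
    (antipode i).val = if i.val < L then i.val + L else i.val - L := by
  have hi := i.isLt
  simp only [antipode, shiftSite]
  split_ifs with hlt
  · exact Nat.mod_eq_of_lt (by omega)
  · rw [Nat.mod_eq_sub_mod (by omega), Nat.mod_eq_of_lt (by omega)]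
    omega

lemma antipode_involutive {L : ℕ} : Function.Involutive (antipode (L := L)) := by
  intro i
  apply Fin.ext
  have hi := i.isLt
  rw [antipode_val, antipode_val]
  split_ifs <;> omega

lemma shiftSite_antipode {L : ℕ} (j : Fin (2 * L)) (k : ℕ) :
    shiftSite (antipode j) k = antipode (shiftSite j k) := by
  apply Fin.ext
  simp only [antipode, shiftSite, Nat.mod_add_mod]
  congr 1
  omega

/-- An interval of length at most half the chain is disjoint from its antipodal interval. -/
lemma antipode_shiftSite_ne {L : ℕ} (j : Fin (2 * L)) {k l : ℕ} (hk : k < L) (hl : l < L) :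
    antipode (shiftSite j k) ≠ shiftSite j l := by
  intro heq
  have hval := congrArg Fin.val heq
  rw [antipode_val] at hval
  have hj := j.isLt
  have hmod : ∀ m, m < L → (shiftSite j m).val =
      if j.val + m < 2 * L then j.val + m else j.val + m - 2 * L := by
    intro m hm
    simp only [shiftSite]
    split_ifs with hlt
    · exact Nat.mod_eq_of_lt hlt
    · rw [Nat.mod_eq_sub_mod (by omega), Nat.mod_eq_of_lt (by omega)]
  have hk' := hmod k hk
  have hl' := hmod l hl
  split_ifs at hval hk' hl' <;> omega

lemma crosscap_one_apply {L D : ℕ} (f : Fin (2 * L) → Fin D) :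
    crosscap L D (1 : Matrix (Fin D) (Fin D) ℂ) f =
      if ∀ i, f i = f (antipode i) then 1 else 0 := by
  have hlo : ∀ j : Fin L, antipode (lo j) = hi j := by
    intro j
    apply Fin.ext
    rw [antipode_val]
    simp [lo, hi]
  simp only [crosscap, Matrix.one_apply, Finset.prod_ite_zero, Finset.prod_const_one,
    Finset.mem_univ, true_imp_iff]
  refine if_congr ⟨fun hf i => ?_, fun hf j => by rw [← hlo]; exact hf _⟩ rfl rfl
  by_cases hlt : i.val < L
  · have hj := hf ⟨i.val, hlt⟩
    rwa [← hlo] at hj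
  · have hj := hf ⟨i.val - L, by omega⟩
    have hi' : i = hi ⟨i.val - L, by omega⟩ := Fin.ext (by simp only [hi]; omega)
    rw [← hi', ← antipode_involutive (lo _), hlo, ← hi'] at hj
    exact hj.symm

open Classical in
/-- The action of a local operator on the identity crosscap state. -/
lemma localOp_mulVec_crosscap_one {D L r : ℕ} (hr : r ≤ L)
    (h : Matrix (Fin r → Fin D) (Fin r → Fin D) ℂ) (j : Fin (2 * L)) (f : Fin (2 * L) → Fin D) :
    (localOp r h j).mulVec (crosscap L D (1 : Matrix (Fin D) (Fin D) ℂ)) f =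
      h (fun k => f (shiftSite j k.val)) (fun k => f (antipode (shiftSite j k.val))) *
        if ∀ i, (∃ k : Fin r, i = shiftSite j k.val) ∨
          (∃ k : Fin r, antipode i = shiftSite j k.val) ∨ f i = f (antipode i) then 1 else 0 := by
  have hdisj : ∀ i, (∃ k : Fin r, i = shiftSite j k.val) →
      ¬ ∃ k : Fin r, antipode i = shiftSite j k.val := by
    rintro _ ⟨k, rfl⟩ ⟨l, hl⟩
    exact antipode_shiftSite_ne j (by omega) (by omega) hl
  simp only [Matrix.mulVec, dotProduct, localOp, Matrix.of_apply, crosscap_one_apply,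
    Finset.prod_ite_zero, Finset.prod_const_one, Finset.mem_univ, true_imp_iff]
  rw [Finset.sum_eq_single
    (fun i => if ∃ k : Fin r, i = shiftSite j k.val then f (antipode i) else f i)]
  · have hwin : ∀ k : Fin r, ∃ l : Fin r, shiftSite j k.val = shiftSite j l.val :=
      fun k => ⟨k, rfl⟩
    simp only [hwin, if_true]
    rw [if_pos, mul_one]
    · congr 1
      refine if_congr (forall_congr' fun i => ?_) rfl rfl
      have hi := hdisj i
      by_cases h1 : ∃ k : Fin r, i = shiftSite j k.val
      · simp [h1, hi h1]
      · by_cases h2 : ∃ k : Fin r, antipode i = shiftSite j k.val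
        · simp only [h1, h2, if_true, if_false, antipode_involutive i, true_or, or_true]
        · simp only [h1, h2, if_false, false_or]
    · intro i
      by_cases h1 : ∃ k : Fin r, i = shiftSite j k.val
      · exact Or.inl h1
      · simp only [h1, if_false, or_true]
  · intro g _ hg
    by_contra hne
    have h1 := right_ne_zero_of_mul hne
    have h2 := right_ne_zero_of_mul (left_ne_zero_of_mul hne)
    simp only [ne_eq, ite_eq_right_iff, one_ne_zero, imp_false, not_not] at h1 h2
    refine hg (funext fun i => ?_)
    split_ifs with hi
    · rw [h1 i, (h2 (antipode i)).resolve_left (hdisj i hi)]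
    · exact ((h2 i).resolve_left hi).symm
  · exact fun hn => absurd (Finset.mem_univ _) hn

/-- Translating an antisymmetric local operator to the antipodal site flips the sign of its
action on the identity crosscap state. -/
lemma localOp_antipode_mulVec_crosscap_one {D L r : ℕ} (hr : r ≤ L)
    {h : Matrix (Fin r → Fin D) (Fin r → Fin D) ℂ} (hanti : hᵀ = -h) (j : Fin (2 * L)) :
    (localOp r h (antipode j)).mulVec (crosscap L D (1 : Matrix (Fin D) (Fin D) ℂ)) =
      -(localOp r h j).mulVec (crosscap L D (1 : Matrix (Fin D) (Fin D) ℂ)) := by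
  classical
  funext f
  have hswap : ∀ a b, h a b = -h b a := fun a b => congrFun (congrFun hanti b) a
  rw [Pi.neg_apply, localOp_mulVec_crosscap_one hr, localOp_mulVec_crosscap_one hr]
  simp only [shiftSite_antipode, antipode_involutive _]
  rw [hswap, neg_mul]
  congr 2
  refine if_congr (forall_congr' fun i => ?_) rfl rfl
  have heq : ∀ k : ℕ, i = antipode (shiftSite j k) ↔ antipode i = shiftSite j k :=
    fun k => antipode_involutive.eq_iff.symm
  simp only [heq, antipode_involutive.injective.eq_iff]
  tauto

/-- if the local operator `h` of range `r ≤ L` is antisymmetric with respect to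
transposition in the computational basis (`hᵀ = -h`), then the translationally invariant
Hamiltonian `H = Σ_j h(j)` annihilates the identity crosscap state `|Ψ₀⟩`
(the crosscap state of the identity matrix). -/
theorem antisymmetric_annihilates_identity_crosscap
    (D L r : ℕ) (hD : 2 ≤ D) (hL : 1 ≤ L) (hr : r ≤ L)
    (h : Matrix (Fin r → Fin D) (Fin r → Fin D) ℂ) (hanti : hᵀ = -h) :
    (∑ j : Fin (2 * L), localOp r h j).mulVec
      (crosscap L D (1 : Matrix (Fin D) (Fin D) ℂ)) = 0 := by
  have hneg : (∑ j : Fin (2 * L), localOp r h j).mulVec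
      (crosscap L D (1 : Matrix (Fin D) (Fin D) ℂ)) =
      -(∑ j : Fin (2 * L), localOp r h j).mulVec
        (crosscap L D (1 : Matrix (Fin D) (Fin D) ℂ)) := by
    rw [Matrix.sum_mulVec, ← Finset.sum_neg_distrib,
      ← Equiv.sum_comp antipode_involutive.toPerm]
    exact Finset.sum_congr rfl fun j _ => localOp_antipode_mulVec_crosscap_one hr hanti j
  exact self_eq_neg.mp hneg
end

section
/- Let L ≥ 2 be even (so the chain length 2L is a multiple of 4) and consider the XX Hamiltonian on a periodic chain of 2L qubits, H_XX = Σ_{j=0}^{2L−1} (X_j X_{j+1} + Y_j Y_{j+1}) with indices mod 2L. Then for every complex number c, the period-2 modulated crosscap state |Ψ̃(c)⟩ = ⊗_{j=0}^{L−1} (|0⟩_j|0⟩_{j+L} + (−i)^L c (−1)^j |1⟩_j|1⟩_{j+L}) satisfies H_XX |Ψ̃(c)⟩ = 0. -/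
open Matrix BigOperators

/-- The Pauli matrix `X`. -/
noncomputable def PX : Matrix (Fin 2) (Fin 2) ℂ := !![0, 1; 1, 0]

/-- The Pauli matrix `Y`. -/
noncomputable def PY : Matrix (Fin 2) (Fin 2) ℂ := !![0, -Complex.I; Complex.I, 0]

/-- The Pauli matrix `Z`. -/
noncomputable def PZ : Matrix (Fin 2) (Fin 2) ℂ := !![1, 0; 0, -1]

/-- The spin raising operator `σ⁺ = |1⟩⟨0|`. -/
noncomputable def sigmaPlus : Matrix (Fin 2) (Fin 2) ℂ := !![0, 0; 1, 0]

/-- The modulated crosscap state `⊗_{j=0}^{L-1} (|0⟩_j|0⟩_{j+L} + β_j |1⟩_j|1⟩_{j+L})`: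
its coefficient on the basis state `f` is the product over `j` of `1` if `f(j) = f(j+L) = 0`,
`β_j` if `f(j) = f(j+L) = 1`, and `0` otherwise. -/
noncomputable def modCrosscap (L : ℕ) (β : Fin L → ℂ) : (Fin (2 * L) → Fin 2) → ℂ :=
  fun f => ∏ j : Fin L,
    if f (lo j) = 0 ∧ f (hi j) = 0 then 1
    else if f (lo j) = 1 ∧ f (hi j) = 1 then β j else 0

theorem oneSite_mulVec_apply {n D : ℕ} (M : Matrix (Fin D) (Fin D) ℂ) (j : Fin n)
    (ψ : (Fin n → Fin D) → ℂ) (f : Fin n → Fin D) :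
    (oneSite M j).mulVec ψ f = ∑ b, M (f j) b * ψ (Function.update f j b) := by
  symm
  refine Finset.sum_of_injOn (fun b => Function.update f j b)
    (Function.update_injective f j).injOn (by simp) ?_ ?_
  · intro g _ hg
    have hne : ∃ i, i ≠ j ∧ f i ≠ g i := by
      by_contra! h
      refine hg ⟨g j, by simp, ?_⟩
      funext i
      by_cases hi : i = j
      · subst hi; simp
      · simp [hi, h i hi]
    obtain ⟨i, hij, hfg⟩ := hne
    have hprod : (∏ i : Fin n, if i = j ∨ f i = g i then (1 : ℂ) else 0) = 0 :=
      Finset.prod_eq_zero (Finset.mem_univ i) (by simp [hij, hfg])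
    simp [oneSite, hprod]
  · intro b _
    have hprod : (∏ i : Fin n,
        if i = j ∨ f i = Function.update f j b i then (1 : ℂ) else 0) = 1 := by
      refine Finset.prod_eq_one fun i _ => if_pos ?_
      by_cases hi : i = j <;> simp [hi]
    simp [oneSite, hprod]

/-- The XX bond operator exchanges the values at two sites where they differ and kills the
configurations in which they agree. -/
theorem xx_bond_mulVec_apply {n : ℕ} {j k : Fin n} (hjk : j ≠ k)
    (ψ : (Fin n → Fin 2) → ℂ) (f : Fin n → Fin 2) :
    (oneSite PX j * oneSite PX k + oneSite PY j * oneSite PY k).mulVec ψ f =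
      if f j = f k then 0 else
        2 * ψ (Function.update (Function.update f j (f k)) k (f j)) := by
  rw [Matrix.add_mulVec, Pi.add_apply, ← Matrix.mulVec_mulVec, ← Matrix.mulVec_mulVec]
  simp only [oneSite_mulVec_apply, Fin.sum_univ_two, Function.update_of_ne hjk.symm]
  generalize f j = a
  generalize f k = b
  fin_cases a <;> fin_cases b <;> simp [PX, PY, ← mul_assoc] <;> ring

/-- The weight of one antipodal pair in a modulated crosscap state. -/
noncomputable def pairWeight (β : ℂ) (a b : Fin 2) : ℂ :=
  if a = 0 ∧ b = 0 then 1 else if a = 1 ∧ b = 1 then β else 0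

theorem pairWeight_comm (β : ℂ) (a b : Fin 2) : pairWeight β a b = pairWeight β b a := by
  simp only [pairWeight, and_comm]

/-- The antipodal pair containing a given site. -/
def pairIndex {L : ℕ} (j : Fin (2 * L)) : Fin L :=
  ⟨j.val % L, Nat.mod_lt _ (by have := j.isLt; omega)⟩

@[simp] theorem pairIndex_lo {L : ℕ} (i : Fin L) : pairIndex (lo i) = i :=
  Fin.ext (Nat.mod_eq_of_lt i.isLt)

@[simp] theorem pairIndex_hi {L : ℕ} (i : Fin L) : pairIndex (hi i) = i :=
  Fin.ext (by simp [pairIndex, hi, Nat.mod_eq_of_lt i.isLt])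

theorem eq_lo_or_eq_hi {L : ℕ} (j : Fin (2 * L)) :
    (∃ i, j = lo i ∧ shiftSite j L = hi i) ∨ ∃ i, j = hi i ∧ shiftSite j L = lo i := by
  have hj := j.isLt
  rcases lt_or_ge j.val L with h | h
  · refine Or.inl ⟨⟨j, h⟩, rfl, Fin.ext ?_⟩
    simp only [shiftSite, hi]
    exact Nat.mod_eq_of_lt (by omega)
  · refine Or.inr ⟨⟨j - L, by omega⟩, Fin.ext ?_, Fin.ext ?_⟩
    · simp only [hi]; omega
    · simp only [shiftSite, lo]
      rw [Nat.mod_eq_sub_mod (by omega), Nat.mod_eq_of_lt (by omega)]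
      omega

theorem pairIndex_shiftSite {L : ℕ} (j : Fin (2 * L)) :
    pairIndex (shiftSite j L) = pairIndex j := by
  rcases eq_lo_or_eq_hi j with ⟨i, h₁, h₂⟩ | ⟨i, h₁, h₂⟩ <;> rw [h₂, h₁] <;> simp

theorem shiftSite_shiftSite {n : ℕ} (j : Fin n) (k l : ℕ) :
    shiftSite (shiftSite j k) l = shiftSite j (k + l) :=
  Fin.ext (by simp [shiftSite, add_assoc])

theorem shiftSite_antipode_antipode {L : ℕ} (j : Fin (2 * L)) :
    shiftSite (shiftSite j L) L = j := by
  rw [shiftSite_shiftSite]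
  exact Fin.ext (by simp [shiftSite, ← two_mul, Nat.mod_eq_of_lt j.isLt])

theorem shiftSite_antipode_ne {L : ℕ} (j : Fin (2 * L)) : shiftSite j L ≠ j := by
  have hj := j.isLt
  rcases eq_lo_or_eq_hi j with ⟨i, h₁, h₂⟩ | ⟨i, h₁, h₂⟩ <;> rw [h₂, h₁] <;>
    simp only [lo, hi, ne_eq, Fin.mk.injEq] <;> omega

theorem pairWeight_pairIndex {L : ℕ} (β : ℂ) (f : Fin (2 * L) → Fin 2) (j : Fin (2 * L)) :
    pairWeight β (f (lo (pairIndex j))) (f (hi (pairIndex j))) =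
      pairWeight β (f j) (f (shiftSite j L)) := by
  rcases eq_lo_or_eq_hi j with ⟨i, h₁, h₂⟩ | ⟨i, h₁, h₂⟩ <;> rw [h₂, h₁]
  · simp
  · rw [pairIndex_hi, pairWeight_comm]

theorem modCrosscap_eq_mul_prod {L : ℕ} (β : Fin L → ℂ) (f : Fin (2 * L) → Fin 2)
    {j k : Fin (2 * L)} (hjk : pairIndex j ≠ pairIndex k) :
    modCrosscap L β f =
      pairWeight (β (pairIndex j)) (f j) (f (shiftSite j L)) *
        (pairWeight (β (pairIndex k)) (f k) (f (shiftSite k L)) *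
          ∏ i ∈ (Finset.univ.erase (pairIndex j)).erase (pairIndex k),
            pairWeight (β i) (f (lo i)) (f (hi i))) := by
  rw [← pairWeight_pairIndex, ← pairWeight_pairIndex,
    Finset.mul_prod_erase _ (fun i => pairWeight (β i) (f (lo i)) (f (hi i)))
      (Finset.mem_erase.2 ⟨hjk.symm, Finset.mem_univ _⟩),
    Finset.mul_prod_erase _ (fun i => pairWeight (β i) (f (lo i)) (f (hi i)))
      (Finset.mem_univ _)]
  rfl

/-- The contributions of two antipodal bonds cancel when the modulation is opposite on the two
antipodal pairs they connect. -/
theorem xx_bond_add_antipodal_bond {L : ℕ} (β : Fin L → ℂ) (f : Fin (2 * L) → Fin 2)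
    {j k : Fin (2 * L)} (hjk : pairIndex j ≠ pairIndex k)
    (hβ : β (pairIndex k) = -β (pairIndex j)) :
    (oneSite PX j * oneSite PX k + oneSite PY j * oneSite PY k).mulVec (modCrosscap L β) f +
      (oneSite PX (shiftSite j L) * oneSite PX (shiftSite k L) +
        oneSite PY (shiftSite j L) * oneSite PY (shiftSite k L)).mulVec
          (modCrosscap L β) f = 0 := by
  have hne : ∀ {s t : Fin (2 * L)}, pairIndex s ≠ pairIndex t → s ≠ t :=
    fun h hst => h (congrArg pairIndex hst)
  have hj := pairIndex_shiftSite j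
  have hk := pairIndex_shiftSite k
  have h₁ : j ≠ k := hne hjk
  have h₂ : shiftSite j L ≠ shiftSite k L := hne (by rwa [hj, hk])
  have h₃ : shiftSite j L ≠ k := hne (by rwa [hj])
  have h₄ : j ≠ shiftSite k L := hne (by rwa [hk])
  have h₅ := shiftSite_antipode_ne j
  have h₆ := shiftSite_antipode_ne k
  have hrest : ∀ (s t : Fin (2 * L)) (a b : Fin 2), pairIndex s = pairIndex j →
      pairIndex t = pairIndex k →
      ∏ i ∈ (Finset.univ.erase (pairIndex j)).erase (pairIndex k),
        pairWeight (β i) (Function.update (Function.update f s a) t b (lo i))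
          (Function.update (Function.update f s a) t b (hi i)) =
      ∏ i ∈ (Finset.univ.erase (pairIndex j)).erase (pairIndex k),
        pairWeight (β i) (f (lo i)) (f (hi i)) := by
    intro s t a b hs ht
    refine Finset.prod_congr rfl fun i hi' => ?_
    simp only [Finset.mem_erase, Finset.mem_univ, and_true] at hi'
    obtain ⟨hik, hij⟩ := hi'
    rw [← hs] at hij
    rw [← ht] at hik
    rw [Function.update_of_ne (hne (by simpa using hik)),
      Function.update_of_ne (hne (by simpa using hij)),
      Function.update_of_ne (hne (by simpa using hik)),
      Function.update_of_ne (hne (by simpa using hij))]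
  rw [xx_bond_mulVec_apply h₁, xx_bond_mulVec_apply h₂, modCrosscap_eq_mul_prod β _ hjk,
    modCrosscap_eq_mul_prod β _ hjk, hrest _ _ _ _ rfl rfl, hrest _ _ _ _ hj hk, hβ]
  simp only [Function.update_apply, h₁, h₂, h₃, h₄, h₅, h₆, h₁.symm, h₂.symm, h₃.symm, h₄.symm,
    h₅.symm, h₆.symm, if_true, if_false]
  generalize f j = a
  generalize f k = b
  generalize f (shiftSite j L) = a'
  generalize f (shiftSite k L) = b'
  fin_cases a <;> fin_cases b <;> fin_cases a' <;> fin_cases b' <;> simp [pairWeight]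

theorem pairIndex_shiftSite_one_val {L : ℕ} (j : Fin (2 * L)) :
    (pairIndex (shiftSite j 1) : ℕ) = ((pairIndex j : ℕ) + 1) % L := by
  simp only [pairIndex, shiftSite]
  rw [Nat.mod_mul_left_mod, Nat.mod_add_mod]

/-- for even `L ≥ 2` (chain length `2L` a multiple of 4) and every `c ∈ ℂ`, the
period-2 modulated crosscap state
`|Ψ̃(c)⟩ = ⊗_j (|0⟩_j|0⟩_{j+L} + (-i)^L c (-1)^j |1⟩_j|1⟩_{j+L})` is annihilated by the XX
Hamiltonian `H_XX = Σ_j (X_j X_{j+1} + Y_j Y_{j+1})`. -/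
theorem xx_modulated_crosscap (L : ℕ) (hL : 2 ≤ L) (hLeven : Even L) (c : ℂ) :
    (∑ j : Fin (2 * L),
        (oneSite PX j * oneSite PX (shiftSite j 1) +
          oneSite PY j * oneSite PY (shiftSite j 1))).mulVec
      (modCrosscap L fun j => (-Complex.I) ^ L * c * (-1) ^ (j : ℕ)) = 0 := by
  funext f
  rw [Matrix.sum_mulVec, Finset.sum_apply, Pi.zero_apply]
  refine Finset.sum_involution (fun j _ => shiftSite j L) (fun j _ => ?_)
    (fun j _ _ => shiftSite_antipode_ne j) (fun _ _ => Finset.mem_univ _)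
    (fun j _ => shiftSite_antipode_antipode j)
  have hval := pairIndex_shiftSite_one_val j
  have hlt := (pairIndex j).isLt
  have hmod : (pairIndex (shiftSite j 1) : ℕ) = pairIndex j + 1 ∨
      (pairIndex (shiftSite j 1) : ℕ) = 0 ∧ (pairIndex j : ℕ) + 1 = L := by
    rcases Nat.lt_or_ge ((pairIndex j : ℕ) + 1) L with h | h
    · exact Or.inl (hval.trans (Nat.mod_eq_of_lt h))
    · have h' : (pairIndex j : ℕ) + 1 = L := by omega
      exact Or.inr ⟨by rw [hval, h', Nat.mod_self], h'⟩
  rw [shiftSite_shiftSite j L 1, add_comm L 1, ← shiftSite_shiftSite j 1 L]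
  refine xx_bond_add_antipodal_bond _ f (fun h => ?_) ?_
  · have := congrArg Fin.val h
    omega
  · rcases hmod with h | ⟨h, h'⟩
    · simp only [h, pow_succ]
      ring
    · have hodd : Odd (pairIndex j : ℕ) := by
        rw [← h', Nat.even_add_one] at hLeven
        exact Nat.not_even_iff_odd.1 hLeven
      simp only [h, hodd.neg_one_pow]
      ring
end
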